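/- arXiv:math/0606367 — 4 statements merged into one kernel-verified Lean document; each statement's English description precedes it below -/
import Mathlib

section
/- Let Γ be a discrete group and let f ∈ ℓ¹(Γ). If the convolution operator ρ_f : ℓ∞(Γ) → ℓ∞(Γ), defined by ρ_f(g)(x) = Σ_{y∈Γ} g(xy) f(y), is injective, then f is invertible in the convolution algebra ℓ¹(Γ); that is, there exists g ∈ ℓ¹(Γ) with f*g = δ_e = g*f. -/
/-- Convolution on `ℓ¹(Γ)`: `(f * g)(z) = ∑_{y} f(zy⁻¹) g(y)`. -/
noncomputable def conv {Γ : Type*} [Group Γ] (f g : Γ → ℂ) : Γ → ℂ :=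
  fun z => ∑' y : Γ, f (z * y⁻¹) * g y

/-- The convolution operator `ρ_f(g)(x) = ∑_{y} g(xy) f(y)`. -/
noncomputable def rho {Γ : Type*} [Group Γ] (f g : Γ → ℂ) : Γ → ℂ :=
  fun x => ∑' y : Γ, g (x * y) * f y

open Classical in
/-- The unit `δ_e` of `ℓ¹(Γ)`, the indicator function of the identity element. -/
noncomputable def deltaOne (Γ : Type*) [Group Γ] : Γ → ℂ :=
  fun z => if z = 1 then 1 else 0

open scoped ENNReal

section LpTranslation

variable {Γ : Type*} {p : ℝ≥0∞}

theorem Memℓp.comp_perm (hp₀ : 0 < p.toReal) (σ : Equiv.Perm Γ) {a : Γ → ℂ}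
    (ha : Memℓp a p) : Memℓp (fun x => a (σ x)) p :=
  memℓp_gen (σ.summable_iff.mpr (ha.summable hp₀))

/-- Precomposition with a permutation, as a linear isometry of `ℓᵖ(Γ)`. -/
noncomputable def lpCompPerm [Fact (1 ≤ p)] (hp : p ≠ ∞) (σ : Equiv.Perm Γ) :
    lp (fun _ : Γ => ℂ) p →ₗᵢ[ℂ] lp (fun _ : Γ => ℂ) p where
  toFun a := ⟨fun x => a (σ x),
    (lp.memℓp a).comp_perm (ENNReal.toReal_pos (zero_lt_one.trans_le Fact.out).ne' hp) σ⟩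
  map_add' _ _ := rfl
  map_smul' _ _ := rfl
  norm_map' a := by
    have hp₀ : 0 < p.toReal := ENNReal.toReal_pos (zero_lt_one.trans_le Fact.out).ne' hp
    change ‖(⟨fun x => a (σ x), _⟩ : lp (fun _ : Γ => ℂ) p)‖ = ‖a‖
    rw [lp.norm_eq_tsum_rpow hp₀, lp.norm_eq_tsum_rpow hp₀]
    congr 1
    exact σ.tsum_eq (fun x => ‖a x‖ ^ p.toReal)

@[simp]
theorem lpCompPerm_apply [Fact (1 ≤ p)] (hp : p ≠ ∞) (σ : Equiv.Perm Γ)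
    (a : lp (fun _ : Γ => ℂ) p) (x : Γ) : lpCompPerm hp σ a x = a (σ x) :=
  rfl

theorem memℓp_one_of_summable {f : Γ → ℂ} (hf : Summable fun x => ‖f x‖) : Memℓp f 1 :=
  memℓp_gen (by simpa using hf)

theorem lp.summable_norm_one (a : lp (fun _ : Γ => ℂ) 1) : Summable fun x => ‖a x‖ := by
  simpa using (lp.memℓp a).summable (by simp)

theorem lp.norm_one_eq_tsum (a : lp (fun _ : Γ => ℂ) 1) : ‖a‖ = ∑' x, ‖a x‖ := by
  simpa using lp.norm_rpow_eq_tsum (by simp) a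

theorem norm_lpCompPerm_le [Fact (1 ≤ p)] (hp : p ≠ ∞) (σ : Equiv.Perm Γ) :
    ‖(lpCompPerm hp σ).toContinuousLinearMap‖ ≤ 1 :=
  (lpCompPerm hp σ).norm_toContinuousLinearMap_le

end LpTranslation

section Convolution

variable {Γ : Type*} [Group Γ] {p : ℝ≥0∞}

open Classical in
/-- The unit mass at the identity, as an element of `ℓᵖ(Γ)`. -/
noncomputable def lpDelta (Γ : Type*) [Group Γ] (p : ℝ≥0∞) : lp (fun _ : Γ => ℂ) p :=
  lp.single p 1 1

theorem lpDelta_eq_single [DecidableEq Γ] : lpDelta Γ p = lp.single p 1 1 := by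
  ext x
  simp [lpDelta, lp.single_apply, Pi.single_apply]

theorem coe_lpDelta : ⇑(lpDelta Γ p) = deltaOne Γ := by
  ext x
  simp [lpDelta, deltaOne, lp.single_apply, Pi.single_apply]

/-- Left convolution by `f` on `ℓᵖ(Γ)`, as a combination of left translations. -/
noncomputable def convCLM [Fact (1 ≤ p)] (hp : p ≠ ∞) (f : Γ → ℂ) :
    lp (fun _ : Γ => ℂ) p →L[ℂ] lp (fun _ : Γ => ℂ) p :=
  ∑' y, f y • (lpCompPerm hp (Equiv.mulLeft y⁻¹)).toContinuousLinearMap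

variable {f g : Γ → ℂ} [Fact (1 ≤ p)]

theorem norm_smul_lpCompPerm_le (hp : p ≠ ∞) (f : Γ → ℂ) (y : Γ) :
    ‖f y • (lpCompPerm hp (Equiv.mulLeft y⁻¹)).toContinuousLinearMap‖ ≤ ‖f y‖ := by
  rw [norm_smul]
  exact mul_le_of_le_one_right (norm_nonneg _) (norm_lpCompPerm_le hp _)

theorem summable_convCLM (hp : p ≠ ∞) (hf : Summable fun x => ‖f x‖) :
    Summable fun y => f y • (lpCompPerm hp (Equiv.mulLeft y⁻¹)).toContinuousLinearMap :=
  .of_norm_bounded hf (norm_smul_lpCompPerm_le hp f)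

theorem norm_convCLM_le (hp : p ≠ ∞) (hf : Summable fun x => ‖f x‖) :
    ‖convCLM hp f‖ ≤ ∑' x, ‖f x‖ :=
  tsum_of_norm_bounded hf.hasSum (norm_smul_lpCompPerm_le hp f)

theorem convCLM_sub (hp : p ≠ ∞) (hf : Summable fun x => ‖f x‖)
    (hg : Summable fun x => ‖g x‖) :
    convCLM hp (f - g) = convCLM hp f - convCLM hp g := by
  simp only [convCLM, Pi.sub_apply, sub_smul]
  exact (summable_convCLM hp hf).tsum_sub (summable_convCLM hp hg)

theorem convCLM_apply (hp : p ≠ ∞) (hf : Summable fun x => ‖f x‖)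
    (a : lp (fun _ : Γ => ℂ) p) (z : Γ) :
    convCLM hp f a z = ∑' y, f y * a (y⁻¹ * z) := by
  have h := (summable_convCLM hp hf).hasSum.mapL (ContinuousLinearMap.apply ℂ _ a)
  exact (h.mapL (lp.evalCLM ℂ (fun _ : Γ => ℂ) p z)).tsum_eq.symm

theorem coe_convCLM (hp : p ≠ ∞) (hf : Summable fun x => ‖f x‖)
    (a : lp (fun _ : Γ => ℂ) p) : ⇑(convCLM hp f a) = conv f a := by
  ext z
  rw [convCLM_apply hp hf, conv, ← (Equiv.divLeft z).tsum_eq]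
  simp [div_eq_mul_inv]

theorem conv_deltaOne (f : Γ → ℂ) : conv f (deltaOne Γ) = f := by
  ext z
  rw [conv, tsum_eq_single 1] <;> simp +contextual [deltaOne]

theorem coe_convCLM_lpDelta (hp : p ≠ ∞) (hf : Summable fun x => ‖f x‖) :
    ⇑(convCLM hp f (lpDelta Γ p)) = f := by
  rw [coe_convCLM hp hf, coe_lpDelta, conv_deltaOne]

theorem convCLM_lpCompPerm_mulRight (hp : p ≠ ∞) (hf : Summable fun x => ‖f x‖) (x : Γ)
    (a : lp (fun _ : Γ => ℂ) p) :
    convCLM hp f (lpCompPerm hp (Equiv.mulRight x) a) =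
      lpCompPerm hp (Equiv.mulRight x) (convCLM hp f a) := by
  ext z
  simp [convCLM_apply hp hf, mul_assoc]

/-- Operators commuting with right translations are determined by their value at `δ_e`. -/
theorem ContinuousLinearMap.ext_of_lpDelta (hp : p ≠ ∞)
    {A B : lp (fun _ : Γ => ℂ) p →L[ℂ] lp (fun _ : Γ => ℂ) p}
    (hA : ∀ x a, A (lpCompPerm hp (Equiv.mulRight x) a) = lpCompPerm hp (Equiv.mulRight x) (A a))
    (hB : ∀ x a, B (lpCompPerm hp (Equiv.mulRight x) a) = lpCompPerm hp (Equiv.mulRight x) (B a))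
    (h : A (lpDelta Γ p) = B (lpDelta Γ p)) : A = B := by
  classical
  refine lp.ext_continuousLinearMap hp fun x => ContinuousLinearMap.ext_ring ?_
  have hx : lp.single p x (1 : ℂ) = lpCompPerm hp (Equiv.mulRight x⁻¹) (lpDelta Γ p) := by
    ext z
    simp [lpDelta, lp.single_apply, Pi.single_apply, mul_inv_eq_one]
  change A (lp.single p x 1) = B (lp.single p x 1)
  rw [hx, hA, hB, h]

theorem summable_norm_deltaOne : Summable fun x => ‖deltaOne Γ x‖ := by
  rw [← coe_lpDelta (p := 1)]
  exact lp.summable_norm_one _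

theorem convCLM_deltaOne (hp : p ≠ ∞) : convCLM hp (deltaOne Γ) = 1 := by
  have hs := summable_norm_deltaOne (Γ := Γ)
  refine ContinuousLinearMap.ext_of_lpDelta hp (convCLM_lpCompPerm_mulRight hp hs)
    (fun _ _ => rfl) (lp.ext ?_)
  rw [coe_convCLM_lpDelta hp hs]
  exact coe_lpDelta.symm

theorem summable_norm_conv (hf : Summable fun x => ‖f x‖) (hg : Summable fun x => ‖g x‖) :
    Summable fun x => ‖conv f g x‖ := by
  have h := lp.summable_norm_one
    (convCLM ENNReal.one_ne_top f ⟨g, memℓp_one_of_summable hg⟩)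
  rwa [coe_convCLM _ hf] at h

theorem convCLM_conv (hp : p ≠ ∞) (hf : Summable fun x => ‖f x‖)
    (hg : Summable fun x => ‖g x‖) :
    convCLM hp (conv f g) = convCLM hp f * convCLM hp g := by
  have hfg := summable_norm_conv hf hg
  refine ContinuousLinearMap.ext_of_lpDelta hp (convCLM_lpCompPerm_mulRight hp hfg)
    (fun x a => ?_) (lp.ext ?_)
  · simp [convCLM_lpCompPerm_mulRight hp hf, convCLM_lpCompPerm_mulRight hp hg]
  · rw [coe_convCLM_lpDelta hp hfg, mul_apply_eq_comp, coe_convCLM hp hf,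
      coe_convCLM_lpDelta hp hg]

theorem eq_of_convCLM_eq (hp : p ≠ ∞) (hf : Summable fun x => ‖f x‖)
    (hg : Summable fun x => ‖g x‖) (h : convCLM hp f = convCLM hp g) : f = g := by
  rw [← coe_convCLM_lpDelta hp hf, h, coe_convCLM_lpDelta hp hg]

end Convolution

section DirectFiniteness

variable {Γ : Type*} [Group Γ] {f g : Γ → ℂ}

theorem inner_lpDelta (a : lp (fun _ : Γ => ℂ) 2) : inner ℂ (lpDelta Γ 2) a = a 1 := by
  classical
  rw [lpDelta_eq_single, lp.inner_single_left]
  simp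

/-- An idempotent of `ℓ¹(Γ)` with vanishing trace acts as zero on `ℓ²(Γ)`. -/
theorem convCLM_eq_zero_of_isIdempotentElem {q : Γ → ℂ} (hq : Summable fun x => ‖q x‖)
    (hidem : IsIdempotentElem (convCLM ENNReal.ofNat_ne_top q :
      lp (fun _ : Γ => ℂ) 2 →L[ℂ] lp (fun _ : Γ => ℂ) 2))
    (hq1 : q 1 = 0) :
    (convCLM ENNReal.ofNat_ne_top q : lp (fun _ : Γ => ℂ) 2 →L[ℂ] lp (fun _ : Γ => ℂ) 2) = 0 := by
  set P : lp (fun _ : Γ => ℂ) 2 →L[ℂ] lp (fun _ : Γ => ℂ) 2 :=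
    convCLM ENNReal.ofNat_ne_top q with hP
  let S (x : Γ) := lpCompPerm (p := 2) ENNReal.ofNat_ne_top (Equiv.mulRight x)
  let K : Submodule ℂ (lp (fun _ : Γ => ℂ) 2) := (1 - P).ker
  have hK : ∀ w, w ∈ K ↔ P w = w := fun w => by
    simp [K, LinearMap.mem_ker, sub_eq_zero, eq_comm (a := w)]
  have hKc : IsClosed (K : Set (lp (fun _ : Γ => ℂ) 2)) := (1 - P).isClosed_ker
  have : CompleteSpace K := hKc.completeSpace_coe
  have hPK : ∀ a, P a ∈ K := fun a => (hK _).2 (congrArg (fun T => T a) hidem)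
  have hSK : ∀ x, ∀ w ∈ K, S x w ∈ K := fun x w hw => by
    rw [hK] at hw ⊢
    rw [hP, convCLM_lpCompPerm_mulRight _ hq, ← hP, hw]
  let v := K.starProjection (lpDelta Γ 2)
  have hvK : v ∈ K := K.starProjection_apply_mem _
  have hv : ∀ w ∈ K, inner ℂ v w = w 1 := fun w hw => by
    have h := K.starProjection_inner_eq_zero (lpDelta Γ 2) w hw
    rw [inner_sub_left, sub_eq_zero, inner_lpDelta] at h
    exact h.symm
  have hvS : ∀ y, inner ℂ v (S y v) = v y := fun y => by
    rw [hv _ (hSK y v hvK)]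
    simp [S]
  have hstar : ∀ y, v y⁻¹ = starRingEnd ℂ (v y) := fun y => by
    have hSS : S y (S y⁻¹ v) = v := by
      ext z
      simp [S]
    rw [← hvS, ← hvS, inner_conj_symm, ← (S y).inner_map_map, hSS]
  have hv1 : v 1 = 0 := by
    have h : inner ℂ v (P (lpDelta Γ 2)) = v 1 := by
      conv_rhs => rw [← (hK v).1 hvK, hP, convCLM_apply _ hq]
      rw [lp.inner_eq_tsum]
      refine tsum_congr fun y => ?_
      rw [hP, coe_convCLM_lpDelta _ hq, mul_one, hstar]
      simp
    rw [← h, hv _ (hPK _), hP, coe_convCLM_lpDelta _ hq, hq1]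
  have hv0 : v = 0 := by
    rw [← inner_self_eq_zero (𝕜 := ℂ), hv v hvK, hv1]
  ext a x
  have h := hv _ (hSK x _ (hPK a))
  rw [hv0, inner_zero_left] at h
  simpa [S] using h.symm

/-- **Kaplansky**: `ℓ¹(Γ)` is directly finite. -/
theorem conv_eq_deltaOne_comm (hf : Summable fun x => ‖f x‖) (hg : Summable fun x => ‖g x‖)
    (h : conv f g = deltaOne Γ) : conv g f = deltaOne Γ := by
  have h2 : (2 : ℝ≥0∞) ≠ ∞ := ENNReal.ofNat_ne_top
  have hgf := summable_norm_conv hg hf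
  have hone : convCLM h2 f * convCLM h2 g = 1 := by
    rw [← convCLM_conv h2 hf hg, h, convCLM_deltaOne]
  have hq : Summable fun x => ‖(deltaOne Γ - conv g f) x‖ :=
    .of_nonneg_of_le (fun _ => norm_nonneg _) (fun x => norm_sub_le _ _)
      (summable_norm_deltaOne.add hgf)
  have hsub := convCLM_sub h2 summable_norm_deltaOne hgf
  have htrace : conv g f 1 = conv f g 1 := by
    rw [conv, conv, ← (Equiv.inv Γ).tsum_eq]
    simp [mul_comm]
  have hzero := convCLM_eq_zero_of_isIdempotentElem hq (by
    rw [hsub, convCLM_deltaOne, convCLM_conv h2 hg hf]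
    refine IsIdempotentElem.one_sub ?_
    rw [IsIdempotentElem, mul_assoc, ← mul_assoc (convCLM h2 f), hone, one_mul]) (by
    rw [Pi.sub_apply, htrace, h, sub_self])
  rw [hsub, sub_eq_zero] at hzero
  exact (eq_of_convCLM_eq h2 summable_norm_deltaOne hgf hzero).symm

end DirectFiniteness

/-- If `ρ_f` is injective, `δ_e` lies in the closed span of the left translates of `f`. -/
theorem lpDelta_mem_closure_span_of_rho_injective {Γ : Type*} [Group Γ]
    (F : lp (fun _ : Γ => ℂ) 1)
    (hinj : ∀ g : Γ → ℂ, (∃ C, ∀ x, ‖g x‖ ≤ C) → rho F g = 0 → g = 0) :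
    lpDelta Γ 1 ∈ (Submodule.span ℂ (Set.range fun x : Γ =>
      lpCompPerm ENNReal.one_ne_top (Equiv.mulLeft x⁻¹) F)).topologicalClosure := by
  classical
  set K := (Submodule.span ℂ (Set.range fun x : Γ =>
    lpCompPerm ENNReal.one_ne_top (Equiv.mulLeft x⁻¹) F)).topologicalClosure
  have : IsClosed (K : Set (lp (fun _ : Γ => ℂ) 1)) := Submodule.isClosed_topologicalClosure _
  by_contra hmem
  obtain ⟨ψ, -, hψ⟩ := exists_dual_vector ℂ (K.mkQ (lpDelta Γ 1))
    (by rwa [norm_ne_zero_iff, Ne, Submodule.mkQ_apply, Submodule.Quotient.mk_eq_zero])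
  let φ := ψ.comp K.mkQL
  have hφK : ∀ a ∈ K, φ a = 0 := fun a ha => by
    change ψ (K.mkQ a) = 0
    rw [Submodule.mkQ_apply, (Submodule.Quotient.mk_eq_zero K).2 ha, map_zero]
  have hg := hinj (fun x => φ (lp.single 1 x 1))
    ⟨‖φ‖, fun x => (φ.le_opNorm _).trans (by rw [lp.norm_single zero_lt_one]; simp)⟩ (by
      ext x
      have hs := (lp.hasSum_single ENNReal.one_ne_top F).mapL
        (φ.comp (lpCompPerm ENNReal.one_ne_top (Equiv.mulLeft x⁻¹)).toContinuousLinearMap)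
      have h0 : φ (lpCompPerm ENNReal.one_ne_top (Equiv.mulLeft x⁻¹) F) = 0 :=
        hφK _ (Submodule.le_topologicalClosure _ (Submodule.subset_span ⟨x, rfl⟩))
      refine Eq.trans (tsum_congr fun y => ?_) (hs.tsum_eq.trans h0)
      have hy : lpCompPerm ENNReal.one_ne_top (Equiv.mulLeft x⁻¹) (lp.single 1 y (F y)) =
          F y • lp.single 1 (x * y) (1 : ℂ) := by
        ext z
        simp [lp.single_apply, Pi.single_apply, inv_mul_eq_iff_eq_mul]
      change _ = φ (lpCompPerm ENNReal.one_ne_top (Equiv.mulLeft x⁻¹) (lp.single 1 y (F y)))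
      rw [hy, map_smul, smul_eq_mul, mul_comm])
  have h1 : φ (lpDelta Γ 1) = 0 := by
    rw [lpDelta_eq_single]
    exact congrFun hg 1
  refine hmem ((Submodule.Quotient.mk_eq_zero K).1 ?_)
  rw [← norm_eq_zero, ← Submodule.mkQ_apply, ← Complex.ofReal_eq_zero]
  exact hψ.symm.trans h1

/-- An element of the closed left ideal generated by `f` which is close to the unit. -/
theorem exists_norm_lpDelta_sub_convCLM_lt_one {Γ : Type*} [Group Γ]
    (F : lp (fun _ : Γ => ℂ) 1)
    (hF : lpDelta Γ 1 ∈ (Submodule.span ℂ (Set.range fun x : Γ =>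
      lpCompPerm ENNReal.one_ne_top (Equiv.mulLeft x⁻¹) F)).topologicalClosure) :
    ∃ h : Γ → ℂ, (Summable fun x => ‖h x‖) ∧
      ‖lpDelta Γ 1 - convCLM ENNReal.one_ne_top h F‖ < 1 := by
  obtain ⟨s, hs, hdist⟩ := Metric.mem_closure_iff.1 hF 1 one_pos
  obtain ⟨c, rfl⟩ := Finsupp.mem_span_range_iff_exists_finsupp.1 hs
  refine ⟨c, summable_of_hasFiniteSupport ?_, ?_⟩
  · exact c.hasFiniteSupport.subset fun x hx => by simpa using hx
  · rw [dist_eq_norm] at hdist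
    have hc : convCLM ENNReal.one_ne_top c = _ := tsum_eq_sum (s := c.support) fun y hy => by
      rw [Finsupp.notMem_support_iff.1 hy, zero_smul]
    rw [hc, sum_apply]
    exact hdist

/-- If `ρ_f : ℓ∞(Γ) → ℓ∞(Γ)` is injective then `f` is invertible in `ℓ¹(Γ)`. -/
theorem stmt0 {Γ : Type*} [Group Γ] (f : Γ → ℂ) (hf : Summable fun x => ‖f x‖)
    (hinj : ∀ g₁ g₂ : Γ → ℂ, (∃ C, ∀ x, ‖g₁ x‖ ≤ C) → (∃ C, ∀ x, ‖g₂ x‖ ≤ C) →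
      rho f g₁ = rho f g₂ → g₁ = g₂) :
    ∃ g : Γ → ℂ, (Summable fun x => ‖g x‖) ∧
      conv f g = deltaOne Γ ∧ conv g f = deltaOne Γ := by
  have h1 : (1 : ℝ≥0∞) ≠ ∞ := ENNReal.one_ne_top
  let F : lp (fun _ : Γ => ℂ) 1 := ⟨f, memℓp_one_of_summable hf⟩
  have hdense := lpDelta_mem_closure_span_of_rho_injective F fun g hg h0 =>
    hinj g 0 hg ⟨0, by simp⟩ (by rw [show rho f g = 0 from h0]; ext; simp [rho])
  obtain ⟨h, hh, hlt⟩ := exists_norm_lpDelta_sub_convCLM_lt_one F hdense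
  have hk := summable_norm_conv hh hf
  have hunit : IsUnit (convCLM h1 (conv h f) :
      lp (fun _ : Γ => ℂ) 1 →L[ℂ] lp (fun _ : Γ => ℂ) 1) := by
    have hcoe : ⇑(lpDelta Γ 1 - convCLM h1 h F) = deltaOne Γ - conv h f := by
      rw [lp.coeFn_sub, coe_lpDelta, coe_convCLM h1 hh]
    have hlt' := (norm_convCLM_le h1 (lp.summable_norm_one _)).trans_lt
      ((lp.norm_one_eq_tsum _).symm.trans_lt hlt)
    rw [hcoe, convCLM_sub h1 summable_norm_deltaOne hk, convCLM_deltaOne] at hlt'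
    simpa using isUnit_one_sub_of_norm_lt_one hlt'
  obtain ⟨T, hT⟩ := hunit.exists_right_inv
  let u := T (lpDelta Γ 1)
  have hu := lp.summable_norm_one u
  have hfu := summable_norm_conv hf hu
  have huh := summable_norm_conv hu hh
  have hhfu : conv h (conv f u) = deltaOne Γ := by
    rw [← coe_convCLM h1 hf, ← coe_convCLM h1 hh, ← coe_lpDelta (p := 1),
      ← mul_apply_eq_comp, ← convCLM_conv h1 hh hf]
    exact congrArg _ (congrArg (fun A => A (lpDelta Γ 1)) hT)
  have hright : conv f (conv u h) = deltaOne Γ := by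
    refine eq_of_convCLM_eq h1 (summable_norm_conv hf huh) summable_norm_deltaOne ?_
    rw [convCLM_conv h1 hf huh, convCLM_conv h1 hu hh, ← mul_assoc, ← convCLM_conv h1 hf hu,
      ← convCLM_conv h1 hfu hh, conv_eq_deltaOne_comm hh hfu hhfu]
  exact ⟨conv u h, huh, hright, conv_eq_deltaOne_comm hf huh hright⟩
end

section
/- For any discrete group Γ, the convolution algebra ℓ¹(Γ) is directly finite: if f, g ∈ ℓ¹(Γ) satisfy g*f = δ_e, then f*g = δ_e. -/
/-- The Hilbert space `ℓ²(ι)`. -/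
noncomputable abbrev EllTwo (ι : Type*) := lp (fun _ : ι => ℂ) 2

namespace EllTwo

/-- Precomposition with a permutation, as an isometry of `ℓ²(ι)`. -/
noncomputable def permute {ι : Type*} (σ : Equiv.Perm ι) : EllTwo ι →ₗᵢ[ℂ] EllTwo ι where
  toFun ξ := ⟨fun i => ξ (σ i), by
    have h := lp.memℓp ξ
    rw [memℓp_gen_iff (by simp)] at h
    exact (memℓp_gen_iff (by simp)).2 (h.comp_injective σ.injective)⟩
  map_add' _ _ := rfl
  map_smul' _ _ := rfl
  norm_map' ξ := by
    have hp : (0 : ℝ) < (2 : ENNReal).toReal := by simp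
    refine Real.rpow_left_injOn hp.ne' (norm_nonneg _) (norm_nonneg _) ?_
    simp only [lp.norm_rpow_eq_tsum hp]
    exact σ.tsum_eq fun i => ‖ξ i‖ ^ (2 : ENNReal).toReal

@[simp]
lemma permute_apply {ι : Type*} (σ : Equiv.Perm ι) (ξ : EllTwo ι) (i : ι) :
    permute σ ξ i = ξ (σ i) := rfl

variable {Γ : Type*} [Group Γ]

/-- The right regular representation on `ℓ²(Γ)`. -/
noncomputable def rightReg (y : Γ) : EllTwo Γ →ₗᵢ[ℂ] EllTwo Γ := permute (Equiv.mulRight y)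

@[simp]
lemma rightReg_apply (y : Γ) (ξ : EllTwo Γ) (z : Γ) : rightReg y ξ z = ξ (z * y) := rfl

lemma rightReg_rightReg_inv (y : Γ) (ξ : EllTwo Γ) : rightReg y (rightReg y⁻¹ ξ) = ξ := by
  ext z
  simp

open Classical in
/-- The canonical cyclic vector of `ℓ²(Γ)`: the indicator of the identity. -/
noncomputable def vacuum (Γ : Type*) [Group Γ] : EllTwo Γ := lp.single 2 1 1

open Classical in
lemma vacuum_apply (z : Γ) : vacuum Γ z = if z = 1 then 1 else 0 := by
  simp [vacuum, Pi.single_apply]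

lemma inner_vacuum_left (ξ : EllTwo Γ) : inner ℂ (vacuum Γ) ξ = ξ 1 := by
  classical
  have := lp.inner_single_left (𝕜 := ℂ) (G := fun _ : Γ => ℂ) 1 1 ξ
  simp only [RCLike.inner_apply, map_one, mul_one] at this
  rw [← this, vacuum]

lemma hasSum_smul_rightReg_vacuum (ξ : EllTwo Γ) :
    HasSum (fun x => ξ x • rightReg x⁻¹ (vacuum Γ)) ξ := by
  classical
  convert lp.hasSum_single (by simp) ξ using 2 with x
  ext z
  simp [vacuum_apply, Pi.single_apply, mul_inv_eq_one]

/-- An operator on `ℓ²(Γ)` is equivariant if it commutes with the right regular representation. -/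
def Equivariant (A : EllTwo Γ →L[ℂ] EllTwo Γ) : Prop :=
  ∀ (y : Γ) (ξ : EllTwo Γ), A (rightReg y ξ) = rightReg y (A ξ)

namespace Equivariant

variable {A B : EllTwo Γ →L[ℂ] EllTwo Γ}

lemma comp (hA : Equivariant A) (hB : Equivariant B) : Equivariant (A ∘L B) := fun y ξ => by
  simp [hB y ξ, hA y]

lemma hasSum_apply (hA : Equivariant A) (ξ : EllTwo Γ) :
    HasSum (fun x => ξ x • rightReg x⁻¹ (A (vacuum Γ))) (A ξ) := by
  simpa [hA _ _] using (hasSum_smul_rightReg_vacuum ξ).mapL A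

lemma eq_of_apply_vacuum (hA : Equivariant A) (hB : Equivariant B)
    (h : A (vacuum Γ) = B (vacuum Γ)) : A = B := by
  ext1 ξ
  exact (hA.hasSum_apply ξ).unique (h ▸ hB.hasSum_apply ξ)

lemma apply_one (hA : Equivariant A) (ξ : EllTwo Γ) :
    A ξ 1 = ∑' x, ξ x * A (vacuum Γ) x⁻¹ := by
  have := (hA.hasSum_apply ξ).mapL (lp.evalCLM ℂ (fun _ : Γ => ℂ) 2 1)
  simpa [lp.evalCLM] using this.tsum_eq.symm

/-- The functional `A ↦ ⟨A δ_e, δ_e⟩` is tracial on equivariant operators. -/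
lemma trace_comm (hA : Equivariant A) (hB : Equivariant B) :
    A (B (vacuum Γ)) 1 = B (A (vacuum Γ)) 1 := by
  rw [hA.apply_one, hB.apply_one, ← (Equiv.inv Γ).tsum_eq]
  simp [mul_comm]

lemma starProjection {K : Submodule ℂ (EllTwo Γ)} [K.HasOrthogonalProjection]
    (hK : ∀ (y : Γ), ∀ ξ ∈ K, rightReg y ξ ∈ K) : Equivariant K.starProjection := fun y ξ => by
  refine Submodule.eq_starProjection_of_mem_of_inner_eq_zero
    (hK _ _ (K.starProjection_apply_mem _)) fun w hw => ?_
  rw [← rightReg_rightReg_inv y w, ← map_sub, LinearIsometry.inner_map_map]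
  exact K.starProjection_inner_eq_zero _ _ (hK _ _ hw)

/-- An equivariant idempotent of trace one is the identity. -/
lemma idempotent_apply_vacuum (hA : Equivariant A) (hidem : ∀ ξ, A (A ξ) = A ξ)
    (htr : A (vacuum Γ) 1 = 1) : A (vacuum Γ) = vacuum Γ := by
  let K := (A - ContinuousLinearMap.id ℂ (EllTwo Γ)).ker
  have mem_K {ξ : EllTwo Γ} : ξ ∈ K ↔ A ξ = ξ := by simp [K, sub_eq_zero]
  have : CompleteSpace K := ContinuousLinearMap.completeSpace_ker _
  have hP : Equivariant K.starProjection := .starProjection fun y ξ hξ => by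
    rw [mem_K] at hξ ⊢
    rw [hA, hξ]
  have htrP : K.starProjection (vacuum Γ) 1 = 1 := by
    rw [← mem_K.1 (K.starProjection_apply_mem (vacuum Γ)), hA.trace_comm hP,
      Submodule.starProjection_eq_self_iff.2 (mem_K.2 (hidem _)), htr]
  rw [← mem_K, ← Submodule.starProjection_eq_self_iff, eq_comm, ← sub_eq_zero,
    ← inner_self_eq_zero (𝕜 := ℂ), inner_sub_right,
    K.starProjection_inner_eq_zero _ _ (K.starProjection_apply_mem _), sub_zero,
    ← inner_conj_symm, inner_vacuum_left]
  simp [htrP, vacuum_apply]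

end Equivariant

/-- Convolution by `f` on the left, as an operator on `ℓ²(Γ)`. -/
noncomputable def leftConv (f : Γ → ℂ) : EllTwo Γ →L[ℂ] EllTwo Γ :=
  ∑' x, f x • (permute (Equiv.mulLeft x⁻¹)).toContinuousLinearMap

lemma leftConv_apply {f : Γ → ℂ} (hf : Summable fun x => ‖f x‖) (ξ : EllTwo Γ) (z : Γ) :
    leftConv f ξ z = ∑' x, f x * ξ (x⁻¹ * z) := by
  have hs : Summable fun x =>
      f x • (permute (Equiv.mulLeft (x⁻¹ : Γ))).toContinuousLinearMap := by
    refine .of_norm_bounded hf fun x => ?_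
    rw [norm_smul]
    exact mul_le_of_le_one_right (norm_nonneg _) (LinearIsometry.norm_toContinuousLinearMap_le _)
  have := (hs.hasSum.mapL (ContinuousLinearMap.apply ℂ (EllTwo Γ) ξ)).mapL
    (lp.evalCLM ℂ (fun _ : Γ => ℂ) 2 z)
  simpa [lp.evalCLM, leftConv] using this.tsum_eq.symm

lemma equivariant_leftConv {f : Γ → ℂ} (hf : Summable fun x => ‖f x‖) :
    Equivariant (leftConv f) := fun y ξ => by
  ext z
  simp [leftConv_apply hf, mul_assoc]

lemma leftConv_vacuum {f : Γ → ℂ} (hf : Summable fun x => ‖f x‖) (z : Γ) :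
    leftConv f (vacuum Γ) z = f z := by
  rw [leftConv_apply hf, tsum_eq_single z]
  · simp [vacuum_apply]
  · intro x hx
    simp [vacuum_apply, inv_mul_eq_one, hx]

lemma leftConv_leftConv_vacuum {f g : Γ → ℂ} (hf : Summable fun x => ‖f x‖)
    (hg : Summable fun x => ‖g x‖) (z : Γ) :
    leftConv f (leftConv g (vacuum Γ)) z = conv f g z := by
  rw [leftConv_apply hf, conv, ← (Equiv.divLeft z).tsum_eq]
  simp [leftConv_vacuum hg, div_eq_mul_inv, mul_assoc]

end EllTwo

open EllTwo in
/-- `ℓ¹(Γ)` is directly finite: `g * f = δ_e` implies `f * g = δ_e`. -/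
theorem stmt4 {Γ : Type*} [Group Γ] (f g : Γ → ℂ)
    (hf : Summable fun x => ‖f x‖) (hg : Summable fun x => ‖g x‖)
    (h : conv g f = deltaOne Γ) : conv f g = deltaOne Γ := by
  have hF := equivariant_leftConv hf
  have hG := equivariant_leftConv hg
  have hGF_vacuum : leftConv g (leftConv f (vacuum Γ)) = vacuum Γ := by
    ext z
    rw [leftConv_leftConv_vacuum hg hf, h, deltaOne, vacuum_apply]
  have hGF : leftConv g ∘L leftConv f = ContinuousLinearMap.id ℂ _ :=
    (hG.comp hF).eq_of_apply_vacuum (fun _ _ => rfl) hGF_vacuum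
  have hFG : leftConv f (leftConv g (vacuum Γ)) = vacuum Γ :=
    (hF.comp hG).idempotent_apply_vacuum
      (fun ξ => congrArg (leftConv f) (DFunLike.congr_fun hGF (leftConv g ξ)))
      ((hF.trace_comm hG).trans (by simp [hGF_vacuum, vacuum_apply]))
  ext z
  rw [← leftConv_leftConv_vacuum hf hg, hFG, vacuum_apply, deltaOne]
end

section
/- Let f ∈ L¹(𝕋) be such that its Fourier coefficient f̂(n) is nonzero for every n ∈ ℤ. Then the convolution operator R_f : L¹(𝕋) → L¹(𝕋), h ↦ h*f, has dense range. -/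
open MeasureTheory AddCircle

/-- Convolving a character with `f` multiplies it by the corresponding Fourier coefficient. -/
theorem fourier_convolution {T : ℝ} [Fact (0 < T)] (f : AddCircle T → ℂ) (n : ℤ)
    (x : AddCircle T) :
    convolution (fourier n) f (ContinuousLinearMap.mul ℂ ℂ) haarAddCircle x
      = fourierCoeff f n * fourier n x := by
  rw [convolution_def, fourierCoeff, mul_comm, ← integral_const_mul,
    ← integral_sub_left_eq_self _ haarAddCircle x]
  refine integral_congr_ae (Filter.Eventually.of_forall fun t => ?_)
  simp only [ContinuousLinearMap.mul_apply', sub_sub_cancel, smul_eq_mul, ← mul_assoc]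
  congr 1
  simp only [fourier_apply, neg_smul, sub_eq_add_neg, smul_add, smul_neg, toCircle_add,
    Circle.coe_mul]

/-- A continuous function has an everywhere-defined convolution with an integrable one. -/
theorem convolutionExistsAt_of_continuous {T : ℝ} [Fact (0 < T)] (h : C(AddCircle T, ℂ))
    {f : AddCircle T → ℂ} (hf : Integrable f haarAddCircle) (x : AddCircle T) :
    ConvolutionExistsAt h f x (ContinuousLinearMap.mul ℂ ℂ) haarAddCircle :=
  (hf.comp_sub_left x).bdd_mul h.continuous.aestronglyMeasurable
    (Filter.Eventually.of_forall h.norm_coe_le_norm)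

/-- The continuous functions obtained by convolving a continuous function with `f`. -/
def continuousConvolutionRange {T : ℝ} [Fact (0 < T)] (f : AddCircle T → ℂ)
    (hf : Integrable f haarAddCircle) : Submodule ℂ C(AddCircle T, ℂ) where
  carrier := {p | ∃ h : C(AddCircle T, ℂ),
    convolution h f (ContinuousLinearMap.mul ℂ ℂ) haarAddCircle = p}
  zero_mem' := ⟨0, by simp⟩
  add_mem' := by
    rintro p q ⟨h, hp⟩ ⟨k, hq⟩
    refine ⟨h + k, ?_⟩
    rw [ContinuousMap.coe_add, ContinuousMap.coe_add, ← hp, ← hq]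
    exact ConvolutionExists.add_distrib (convolutionExistsAt_of_continuous h hf)
      (convolutionExistsAt_of_continuous k hf)
  smul_mem' := by
    rintro c p ⟨h, hp⟩
    refine ⟨c • h, ?_⟩
    rw [ContinuousMap.coe_smul, ContinuousMap.coe_smul, smul_convolution, hp]

/-- If `f` has nonvanishing Fourier coefficients, then the convolutions of `f` with continuous
functions are uniformly dense in the continuous functions. -/
theorem continuousConvolutionRange_topologicalClosure_eq_top {T : ℝ} [Fact (0 < T)]
    (f : AddCircle T → ℂ) (hf : Integrable f haarAddCircle)
    (hcoef : ∀ n : ℤ, fourierCoeff f n ≠ 0) :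
    (continuousConvolutionRange f hf).topologicalClosure = ⊤ := by
  rw [eq_top_iff, ← span_fourier_closure_eq_top]
  refine Submodule.topologicalClosure_mono (Submodule.span_le.2 ?_)
  rintro _ ⟨n, rfl⟩
  refine ⟨(fourierCoeff f n)⁻¹ • fourier n, funext fun x => ?_⟩
  rw [ContinuousMap.coe_smul, smul_convolution, Pi.smul_apply, fourier_convolution, smul_eq_mul,
    inv_mul_cancel_left₀ (hcoef n)]

/-- If `f ∈ L¹(𝕋)` has nonvanishing Fourier coefficients, then the convolution operator
`R_f : L¹(𝕋) → L¹(𝕋)`, `h ↦ h * f`, has dense range. -/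
theorem stmt8 {T : ℝ} [hT : Fact (0 < T)] (f : AddCircle T → ℂ)
    (hf : Integrable f haarAddCircle)
    (hcoef : ∀ n : ℤ, fourierCoeff f n ≠ 0) :
    ∀ g : AddCircle T → ℂ, Integrable g haarAddCircle →
      ∀ ε : ℝ, 0 < ε → ∃ h : AddCircle T → ℂ, Integrable h haarAddCircle ∧
        ∫ x, ‖MeasureTheory.convolution h f (ContinuousLinearMap.mul ℂ ℂ) haarAddCircle x
            - g x‖ ∂haarAddCircle < ε := by
  intro g hg ε hε
  obtain ⟨k, -, hgk, hk, hki⟩ :=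
    hg.exists_hasCompactSupport_integral_sub_le (show 0 < ε / 2 by positivity)
  have hdense : (⟨k, hk⟩ : C(AddCircle T, ℂ)) ∈
      (continuousConvolutionRange f hf).topologicalClosure := by
    simp [continuousConvolutionRange_topologicalClosure_eq_top f hf hcoef]
  obtain ⟨p, ⟨h, hp⟩, hkp⟩ := Metric.mem_closure_iff.1 hdense (ε / 2) (by positivity)
  have integrable (q : C(AddCircle T, ℂ)) : Integrable q haarAddCircle :=
    q.continuous.integrable_of_hasCompactSupport (HasCompactSupport.of_compactSpace q)
  refine ⟨h, integrable h, ?_⟩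
  rw [hp]
  have hbound (x : AddCircle T) : ‖p x - g x‖ ≤ dist ⟨k, hk⟩ p + ‖g x - k x‖ := by
    have hx := ContinuousMap.dist_apply_le_dist (f := ⟨k, hk⟩) (g := p) x
    rw [dist_comm, dist_eq_norm] at hx
    rw [norm_sub_rev (g x)]
    exact (norm_sub_le_norm_sub_add_norm_sub _ (k x) _).trans (add_le_add_left hx _)
  have hgk_int : Integrable (fun x => ‖g x - k x‖) haarAddCircle := (hg.sub hki).norm
  calc ∫ x, ‖p x - g x‖ ∂haarAddCircle
      ≤ ∫ x, (dist ⟨k, hk⟩ p + ‖g x - k x‖) ∂haarAddCircle :=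
        integral_mono ((integrable p).sub hg).norm ((integrable_const _).add hgk_int) hbound
    _ = dist ⟨k, hk⟩ p + ∫ x, ‖g x - k x‖ ∂haarAddCircle := by
        rw [integral_add (integrable_const _) hgk_int]
        simp
    _ < ε := by linarith
end

section
/- Let Γ be a discrete group and let ω be a weight on Γ (i.e. ω : Γ → (0,∞) with ω(xy) ≤ ω(x)ω(y) for all x,y ∈ Γ) such that inf_{x∈Γ} ω(x) > 0. Then the weighted convolution algebra ℓ¹(Γ,ω) is directly finite: if f, g : Γ → ℂ satisfy Σ_x |f(x)|ω(x) < ∞, Σ_x |g(x)|ω(x) < ∞, and g*f = δ_e, then f*g = δ_e. -/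
open scoped InnerProductSpace

namespace HilbertBasis

variable {ι H : Type*} [NormedAddCommGroup H] [InnerProductSpace ℂ H]

theorem ext_continuousLinearMap (b : HilbertBasis ι ℂ H) {S T : H →L[ℂ] H}
    (h : ∀ i, S (b i) = T (b i)) : S = T :=
  ContinuousLinearMap.ext_on
    (Submodule.dense_iff_topologicalClosure_eq_top.mpr b.dense_span)
    (by rintro _ ⟨i, rfl⟩; exact h i)

/-- The unitary operator permuting the vectors of a Hilbert basis. -/
noncomputable def permute [CompleteSpace H] (b : HilbertBasis ι ℂ H) (σ : Equiv.Perm ι) :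
    H ≃ₗᵢ[ℂ] H :=
  b.repr.trans (HilbertBasis.mk (b.orthonormal.comp σ σ.injective)
    (by rw [σ.surjective.range_comp, b.dense_span])).repr.symm

theorem permute_self [CompleteSpace H] (b : HilbertBasis ι ℂ H) (σ : Equiv.Perm ι) (i : ι) :
    b.permute σ (b i) = b (σ i) := by
  classical
  rw [permute, LinearIsometryEquiv.trans_apply, b.repr_self, HilbertBasis.repr_symm_single,
    HilbertBasis.coe_mk, Function.comp_apply]

end HilbertBasis

section GroupBasis

variable {Γ H : Type*} [Group Γ] [NormedAddCommGroup H] [InnerProductSpace ℂ H] [CompleteSpace H]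

/-- `T` commutes with the right translations of a Hilbert basis indexed by a group. -/
def CommutesWithRightTranslations (b : HilbertBasis Γ ℂ H) (T : H →L[ℂ] H) : Prop :=
  ∀ (x : Γ) (v : H), T (b.permute (Equiv.mulRight x) v) = b.permute (Equiv.mulRight x) (T v)

variable {b : HilbertBasis Γ ℂ H}

namespace CommutesWithRightTranslations

variable {S T : H →L[ℂ] H}

theorem comp (hS : CommutesWithRightTranslations b S) (hT : CommutesWithRightTranslations b T) :
    CommutesWithRightTranslations b (S ∘L T) := fun x v => by
  simp only [ContinuousLinearMap.comp_apply, hT x v, hS x (T v)]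

theorem inner_basis_one (hS : CommutesWithRightTranslations b S) (y : Γ) :
    ⟪b 1, S (b y)⟫_ℂ = ⟪b y⁻¹, S (b 1)⟫_ℂ := by
  rw [← LinearIsometryEquiv.inner_map_map (b.permute (Equiv.mulRight y)) (b y⁻¹), ← hS,
    b.permute_self, b.permute_self]
  simp

theorem ext_basis_one (hS : CommutesWithRightTranslations b S)
    (hT : CommutesWithRightTranslations b T) (h : S (b 1) = T (b 1)) : S = T := by
  refine b.ext_continuousLinearMap fun x => ?_
  have hx : b x = b.permute (Equiv.mulRight x) (b 1) := by simp [b.permute_self]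
  rw [hx, hS, hT, h]

theorem hasSum_trace_comp (b : HilbertBasis Γ ℂ H) (S T : H →L[ℂ] H)
    (hS : CommutesWithRightTranslations b S) :
    HasSum (fun y => ⟪b y⁻¹, S (b 1)⟫_ℂ * ⟪b y, T (b 1)⟫_ℂ) ⟪b 1, S (T (b 1))⟫_ℂ := by
  have h := (b.hasSum_repr (T (b 1))).mapL ((innerSL ℂ (b 1)) ∘L S)
  simp only [ContinuousLinearMap.comp_apply, map_smul, innerSL_apply_apply, smul_eq_mul,
    b.repr_apply_apply, hS.inner_basis_one] at h
  simpa only [mul_comm] using h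

/-- The vector state at `b 1` is a trace. -/
theorem trace_comp_comm (hS : CommutesWithRightTranslations b S)
    (hT : CommutesWithRightTranslations b T) :
    ⟪b 1, S (T (b 1))⟫_ℂ = ⟪b 1, T (S (b 1))⟫_ℂ := by
  refine (hasSum_trace_comp b S T hS).unique ?_
  rw [← (Equiv.inv Γ).hasSum_iff]
  simpa [Function.comp_def, mul_comm] using hasSum_trace_comp b T S hT

theorem starProjection_range [T.range.HasOrthogonalProjection]
    (hT : CommutesWithRightTranslations b T) :
    CommutesWithRightTranslations b T.range.starProjection := by
  intro x v
  obtain ⟨w, hw⟩ := LinearMap.mem_range.mp (T.range.starProjection_apply_mem v)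
  refine Submodule.eq_starProjection_of_mem_of_inner_eq_zero ?_ ?_
  · exact ⟨b.permute (Equiv.mulRight x) w, by rw [← hw]; exact hT x w⟩
  · rintro _ ⟨u, rfl⟩
    obtain ⟨u, rfl⟩ := (b.permute (Equiv.mulRight x)).surjective u
    rw [← map_sub, ContinuousLinearMap.coe_coe, hT, LinearIsometryEquiv.inner_map_map]
    exact Submodule.starProjection_inner_eq_zero _ _ ⟨u, rfl⟩

/-- The algebra of operators commuting with right translations is directly finite. -/
theorem apply_basis_one_of_comp_eq_id (hS : CommutesWithRightTranslations b S)
    (hT : CommutesWithRightTranslations b T) (h : ∀ v, S (T v) = v) :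
    T (S (b 1)) = b 1 := by
  have hclosed : IsClosed (T.range : Set H) :=
    Function.LeftInverse.isClosed_range (f := S) (g := T) h S.continuous T.continuous
  have : CompleteSpace T.range := hclosed.completeSpace_coe
  set E := T.range.starProjection with hE
  have hEc : CommutesWithRightTranslations b E := hT.starProjection_range
  have hET (v : H) : E (T v) = T v :=
    Submodule.starProjection_eq_self_iff.mpr ⟨v, rfl⟩
  have hTSE (v : H) : T (S (E v)) = E v := by
    obtain ⟨w, hw⟩ := LinearMap.mem_range.mp (T.range.starProjection_apply_mem v)
    rw [hE, ← hw, ContinuousLinearMap.coe_coe, h]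
  have hone : ⟪b 1, b 1⟫_ℂ = 1 := by
    simp [inner_self_eq_norm_sq_to_K, b.orthonormal.1 1]
  have htr : ⟪b 1, E (b 1)⟫_ℂ = 1 := by
    rw [← hTSE, ← ContinuousLinearMap.comp_apply T S, trace_comp_comm (hT.comp hS) hEc,
      ContinuousLinearMap.comp_apply, hET, trace_comp_comm hT hS, h, hone]
  have hE1 : b 1 - E (b 1) = 0 := by
    rw [← inner_self_eq_zero (𝕜 := ℂ), inner_sub_right,
      Submodule.starProjection_inner_eq_zero _ _ (Submodule.starProjection_apply_mem _ _),
      sub_zero, inner_sub_left, hone, ← inner_conj_symm, htr, map_one, sub_self]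
  rw [sub_eq_zero] at hE1
  rw [hE1, hTSE]

end CommutesWithRightTranslations

/-- Left convolution by `f`, as an operator on a Hilbert space with a basis indexed by the group. -/
noncomputable def leftConvolution (b : HilbertBasis Γ ℂ H) (f : Γ → ℂ) : H →L[ℂ] H :=
  ∑' x, f x • (b.permute (Equiv.mulLeft x)).toContinuousLinearEquiv.toContinuousLinearMap

variable {f g : Γ → ℂ}

theorem hasSum_leftConvolution_apply (hf : Summable fun x => ‖f x‖) (v : H) :
    HasSum (fun x => f x • b.permute (Equiv.mulLeft x) v) (leftConvolution b f v) := by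
  have hs : Summable fun x =>
      f x • (b.permute (Equiv.mulLeft x)).toContinuousLinearEquiv.toContinuousLinearMap := by
    refine Summable.of_norm_bounded hf fun x => ?_
    refine ContinuousLinearMap.opNorm_le_bound _ (norm_nonneg _) fun v => ?_
    simp [norm_smul]
  exact hs.hasSum.mapL (ContinuousLinearMap.apply ℂ H v)

theorem commutesWithRightTranslations_leftConvolution (hf : Summable fun x => ‖f x‖) :
    CommutesWithRightTranslations b (leftConvolution b f) := by
  intro x v
  refine (hasSum_leftConvolution_apply hf _).unique ?_
  convert! (hasSum_leftConvolution_apply (b := b) hf v).mapL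
    (b.permute (Equiv.mulRight x)).toContinuousLinearEquiv.toContinuousLinearMap using 2 with y
  have hcomm : ((b.permute (Equiv.mulLeft y)).toContinuousLinearEquiv.toContinuousLinearMap ∘L
      (b.permute (Equiv.mulRight x)).toContinuousLinearEquiv.toContinuousLinearMap) =
      ((b.permute (Equiv.mulRight x)).toContinuousLinearEquiv.toContinuousLinearMap ∘L
      (b.permute (Equiv.mulLeft y)).toContinuousLinearEquiv.toContinuousLinearMap) :=
    b.ext_continuousLinearMap fun z => by simp [b.permute_self, mul_assoc]
  have := congrArg (fun A => f y • A v) hcomm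
  simpa using this

theorem inner_leftConvolution_basis (hf : Summable fun x => ‖f x‖) (z y : Γ) :
    ⟪b z, leftConvolution b f (b y)⟫_ℂ = f (z * y⁻¹) := by
  classical
  refine ((hasSum_leftConvolution_apply hf (b y)).mapL (innerSL ℂ (b z))).unique ?_
  convert! hasSum_ite_eq (z * y⁻¹) (f (z * y⁻¹)) using 2 with x
  simp only [b.permute_self, map_smul, innerSL_apply_apply, Equiv.coe_mulLeft,
    orthonormal_iff_ite.mp b.orthonormal, smul_eq_mul, mul_ite, mul_one, mul_zero]
  by_cases hx : x = z * y⁻¹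
  · simp [hx]
  · rw [if_neg hx, if_neg fun h => hx (eq_mul_inv_of_mul_eq h.symm)]

theorem inner_leftConvolution_leftConvolution (hf : Summable fun x => ‖f x‖)
    (hg : Summable fun x => ‖g x‖) (z : Γ) :
    ⟪b z, leftConvolution b f (leftConvolution b g (b 1))⟫_ℂ = conv f g z := by
  have h := (b.hasSum_repr (leftConvolution b g (b 1))).mapL
    ((innerSL ℂ (b z)) ∘L leftConvolution b f)
  simp only [ContinuousLinearMap.comp_apply, map_smul, innerSL_apply_apply, smul_eq_mul,
    b.repr_apply_apply, inner_leftConvolution_basis hf, inner_leftConvolution_basis hg,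
    inv_one, mul_one] at h
  simpa only [conv, mul_comm] using h.tsum_eq.symm

theorem conv_eq_deltaOne_iff (b : HilbertBasis Γ ℂ H) (hf : Summable fun x => ‖f x‖)
    (hg : Summable fun x => ‖g x‖) :
    conv f g = deltaOne Γ ↔ leftConvolution b f (leftConvolution b g (b 1)) = b 1 := by
  classical
  have hdelta (z : Γ) : ⟪b z, b 1⟫_ℂ = deltaOne Γ z := by
    rw [orthonormal_iff_ite.mp b.orthonormal, deltaOne]
  rw [← b.repr.injective.eq_iff, lp.ext_iff, funext_iff, funext_iff]
  simp only [b.repr_apply_apply, inner_leftConvolution_leftConvolution hf hg, hdelta]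

end GroupBasis

theorem Summable.norm_of_norm_mul_weight {α : Type*} {ω : α → ℝ} {c : ℝ} (hc : 0 < c)
    (hω : ∀ x, c ≤ ω x) {f : α → ℂ} (hf : Summable fun x => ‖f x‖ * ω x) :
    Summable fun x => ‖f x‖ :=
  (hf.mul_right c⁻¹).of_nonneg_of_le (fun _ => norm_nonneg _) fun x => by
    rw [← div_eq_mul_inv, le_div_iff₀ hc]
    exact mul_le_mul_of_nonneg_left (hω x) (norm_nonneg _)

/-- If `ω` is a weight on `Γ` with `inf_x ω(x) > 0`, then `ℓ¹(Γ,ω)` is directly finite: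
`g * f = δ_e` implies `f * g = δ_e`. -/
theorem stmt12 {Γ : Type*} [Group Γ] (ω : Γ → ℝ)
    (hωpos : ∀ x, 0 < ω x) (hωsub : ∀ x y, ω (x * y) ≤ ω x * ω y)
    (hinf : ∃ c : ℝ, 0 < c ∧ ∀ x, c ≤ ω x)
    (f g : Γ → ℂ)
    (hf : Summable fun x => ‖f x‖ * ω x) (hg : Summable fun x => ‖g x‖ * ω x)
    (h : conv g f = deltaOne Γ) : conv f g = deltaOne Γ := by
  obtain ⟨c, hc, hω⟩ := hinf
  have hf' := hf.norm_of_norm_mul_weight hc hω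
  have hg' := hg.norm_of_norm_mul_weight hc hω
  let b : HilbertBasis Γ ℂ (lp (fun _ : Γ => ℂ) 2) := default
  have hF := commutesWithRightTranslations_leftConvolution (b := b) hf'
  have hG := commutesWithRightTranslations_leftConvolution (b := b) hg'
  rw [conv_eq_deltaOne_iff b hg' hf'] at h
  rw [conv_eq_deltaOne_iff b hf' hg']
  have hid : leftConvolution b g ∘L leftConvolution b f = .id ℂ _ :=
    (hG.comp hF).ext_basis_one (fun _ _ => rfl) h
  exact hG.apply_basis_one_of_comp_eq_id hF fun v => congrArg (· v) hid
end
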